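/- Limit of the annihilation operator to the Calogero annihilation operator: for every nonnegative integer n, real α>−1 and real x ≠ 0, lim_{q→1⁻} (1−q²)^{(α+1)/2} · (q^{1/2}/(√(1−q)·√(1−q²)·x)) · [ √(1+q^{−2α−3}(1−q²)x²) · φ_n^α(q^{−1}√(1−q²)x ; q) − q^{(2α+1)θ(n)} · φ_n^α(√(1−q²)x ; q) ] = (1/√2) · [ (φ_n^{α+1/2})'(x) + ((α+1/2)/x)(φ_n^{α+1/2}(x) − φ_n^{α+1/2}(−x)) + x·φ_n^{α+1/2}(x) ], where θ(n)=1 if n is odd and θ(n)=0 if n is even. -/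

import Mathlib

open scoped BigOperators
open Real Filter

noncomputable section

/-- q-shifted factorial `(a;q)_n`. -/
def qPoch (a q : ℝ) (n : ℕ) : ℝ := ∏ k ∈ Finset.range n, (1 - a * q ^ k)

/-- infinite q-shifted factorial `(a;q)_∞`. -/
def qPochInf (a q : ℝ) : ℝ := ∏' k : ℕ, (1 - a * q ^ k)

/-- q-number `⟦x⟧_q = (1-q^x)/(1-q)`. -/
def qNumber (q x : ℝ) : ℝ := (1 - q ^ x) / (1 - q)

/-- generalized q-integer `⟦n⟧_{q,α}`: equals `⟦n⟧_q` for even `n` and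
`⟦n+2α+1⟧_q` for odd `n` (so `⟦2m+1⟧_{q,α} = ⟦2m+2α+2⟧_q`). -/
def qNumAlpha (q α : ℝ) (n : ℕ) : ℝ :=
  if n % 2 = 0 then qNumber q n else qNumber q (n + 2 * α + 1)

/-- generalized q-factorial `n!_{q,α}`. -/
def qFactAlpha (q α : ℝ) (n : ℕ) : ℝ := ∏ k ∈ Finset.range n, qNumAlpha q α (k + 1)

/-- generalized q-shifted factorial `(q;q)_{n,α} = (1-q)^n n!_{q,α}`. -/
def qPochAlpha (q α : ℝ) (n : ℕ) : ℝ := (1 - q) ^ n * qFactAlpha q α n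

/-- generalized discrete q-Hermite II polynomials `h̃_{n,α}(x;q)`. -/
def hTilde (q α : ℝ) (n : ℕ) (x : ℝ) : ℝ :=
  qPoch q q n * ∑ k ∈ Finset.range (n / 2 + 1),
    (-1 : ℝ) ^ k * q ^ ((k * (2 * k + 1) : ℤ) - (2 * n * k : ℤ)) * x ^ (n - 2 * k) /
      (qPoch (q ^ 2) (q ^ 2) k * qPochAlpha q α (n - 2 * k))

/-- the weight `ω_α(x;q) = e_{q²}(-q^{-2α-1}x²) = 1/∏_{k≥0}(1+q^{-2α-1}x²q^{2k})`. -/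
def omegaAlpha (q α x : ℝ) : ℝ :=
  (∏' k : ℕ, (1 + q ^ (-(2 * α + 1)) * x ^ 2 * q ^ (2 * k)))⁻¹

/-- normalization constant `c_α`. -/
def cAlpha (q α : ℝ) : ℝ :=
  Real.sqrt (qPochInf (-q ^ (-(2 * α + 1))) (q ^ 2) * qPochInf (-q ^ (2 * α + 3)) (q ^ 2) *
      qPochInf (q ^ (2 * α + 2)) (q ^ 2) /
    (2 * (1 - q) *
      (qPochInf (-q) (q ^ 2) * qPochInf (-q) (q ^ 2) * qPochInf (q ^ 2) (q ^ 2))))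

/-- normalization constant `d_{n,α} = c_α q^{n²/2} (q;q)_{n,α}^{1/2} / (q;q)_n`. -/
def dAlpha (q α : ℝ) (n : ℕ) : ℝ :=
  cAlpha q α * q ^ (((n : ℝ) ^ 2) / 2) * Real.sqrt (qPochAlpha q α n) / qPoch q q n

/-- the (q,α)-deformed Hermite functions `φ_n^α(x;q)`. -/
def phiQ (q α : ℝ) (n : ℕ) (x : ℝ) : ℝ :=
  dAlpha q α n * Real.sqrt (omegaAlpha q α x) * hTilde q α n x

/-- parity indicator `θ(n)`: 1 if `n` is odd, 0 if `n` is even. -/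
def theta (n : ℕ) : ℝ := if n % 2 = 1 then 1 else 0

/-- the q-Gamma function `Γ_q(z) = (q;q)_∞ / (q^z;q)_∞ · (1-q)^{1-z}`. -/
def qGammaF (q z : ℝ) : ℝ := qPochInf q q / qPochInf (q ^ z) q * (1 - q) ^ (1 - z)

/-- Rosenblum generalized factorial `γ_ν(n)`. -/
def gammaGen (ν : ℝ) (n : ℕ) : ℝ :=
  2 ^ n * (Nat.factorial (n / 2) : ℝ) *
    Real.Gamma (ν + (((n + 1) / 2 : ℕ) : ℝ) + 1 / 2) / Real.Gamma (ν + 1 / 2)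

/-- generalized Hermite polynomials `H_n^ν(x)`. -/
def HGen (ν : ℝ) (n : ℕ) (x : ℝ) : ℝ :=
  (Nat.factorial n : ℝ) * ∑ k ∈ Finset.range (n / 2 + 1),
    (-1 : ℝ) ^ k * (2 * x) ^ (n - 2 * k) / ((Nat.factorial k : ℝ) * gammaGen ν (n - 2 * k))

/-- Rosenblum generalized Hermite functions `φ_n^ν(x)`. -/
def phiGen (ν : ℝ) (n : ℕ) (x : ℝ) : ℝ :=
  Real.sqrt (gammaGen ν n / Real.Gamma (ν + 1 / 2)) * Real.exp (-x ^ 2 / 2) *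
    HGen ν n x / ((2 : ℝ) ^ ((n : ℝ) / 2) * (Nat.factorial n : ℝ))

/-- symmetric q-number `[x]_s = (s^x - s^{-x})/(s - s^{-1})`. -/
def qNumSym (s x : ℝ) : ℝ := (s ^ x - s ^ (-x)) / (s - s⁻¹)

/-- Euler q-exponential `e_q(z) = Σ z^k/(q;q)_k`. -/
def eExp (q z : ℝ) : ℝ := ∑' k : ℕ, z ^ k / qPoch q q k

/-- generalized q-exponential `E_{q,α}(z) = Σ q^{k(k-1)/2} z^k/(q;q)_{k,α}`. -/
def bigEAlpha (q α z : ℝ) : ℝ := ∑' k : ℕ, q ^ (k * (k - 1) / 2) * z ^ k / qPochAlpha q α k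

/-- generalized q-exponential `e_{q,α}(z) = Σ z^k/(q;q)_{k,α}`. -/
def eExpAlpha (q α z : ℝ) : ℝ := ∑' k : ℕ, z ^ k / qPochAlpha q α k

lemma summ_geo (a q : ℝ) (h0 : 0 < q) (h1 : q < 1) : Summable (fun k : ℕ => -(a * q ^ k)) :=
  ((summable_geometric_of_lt_one h0.le h1).mul_left a).neg

lemma mult_poch (a q : ℝ) (h0 : 0 < q) (h1 : q < 1) :
    Multipliable (fun k : ℕ => 1 - a * q ^ k) := by
  have := Real.multipliable_one_add_of_summable (summ_geo a q h0 h1)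
  simpa [sub_eq_add_neg] using this

lemma tendsto_poch (a q : ℝ) (h0 : 0 < q) (h1 : q < 1) :
    Tendsto (fun n => ∏ k ∈ Finset.range n, (1 - a * q ^ k)) atTop (nhds (qPochInf a q)) :=
  (mult_poch a q h0 h1).tendsto_prod_tprod_nat

lemma pochInf_step (a q : ℝ) (h0 : 0 < q) (h1 : q < 1) :
    qPochInf a q = (1 - a) * qPochInf (a * q) q := by
  unfold qPochInf
  rw [tprod_eq_zero_mul']
  · simp only [pow_zero, mul_one]
    congr 2
    ext k
    ring
  · have := mult_poch (a * q) q h0 h1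
    refine this.congr ?_
    intro k
    ring

lemma pochInf_pos (a q : ℝ) (h0 : 0 < q) (h1 : q < 1) (ha : a < 1) : 0 < qPochInf a q := by
  unfold qPochInf
  rw [← Real.rexp_tsum_eq_tprod]
  · exact Real.exp_pos _
  · intro k
    have h2 : q ^ k ≤ 1 := pow_le_one₀ h0.le h1.le
    have h3 : 0 < q ^ k := pow_pos h0 k
    nlinarith
  · have := Real.summable_log_one_add_of_summable (summ_geo a q h0 h1)
    simpa [sub_eq_add_neg] using this

lemma rpow_lt_one' (p z : ℝ) (h0 : 0 < p) (h1 : p < 1) (hz : 0 < z) : p ^ z < 1 :=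
  Real.rpow_lt_one h0.le h1 hz

lemma qGamma_pos (p z : ℝ) (h0 : 0 < p) (h1 : p < 1) (hz : 0 < z) : 0 < qGammaF p z := by
  unfold qGammaF
  have := pochInf_pos p p h0 h1 h1
  have := pochInf_pos (p ^ z) p h0 h1 (rpow_lt_one' p z h0 h1 hz)
  have := Real.rpow_pos_of_pos (sub_pos.2 h1) (1 - z)
  positivity

lemma qNumber_pos (p z : ℝ) (h0 : 0 < p) (h1 : p < 1) (hz : 0 < z) : 0 < qNumber p z := by
  unfold qNumber
  have := rpow_lt_one' p z h0 h1 hz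
  exact div_pos (by linarith) (by linarith)

lemma qGamma_step (p z : ℝ) (h0 : 0 < p) (h1 : p < 1) (hz : 0 < z) :
    qGammaF p (z + 1) = qNumber p z * qGammaF p z := by
  unfold qGammaF qNumber
  rw [pochInf_step (p ^ z) p h0 h1, Real.rpow_add h0, Real.rpow_one]
  have h2 := pochInf_pos (p ^ z * p) p h0 h1 (by
    have := rpow_lt_one' p z h0 h1 hz
    have := Real.rpow_pos_of_pos h0 z
    nlinarith)
  have h3 := rpow_lt_one' p z h0 h1 hz
  have h4 : (1 - p) ^ (1 - z) = (1 - p) ^ (1 - (z + 1)) * (1 - p) := by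
    rw [← Real.rpow_add_one (by linarith)]
    congr 1; ring
  rw [h4]
  have : 1 - p ≠ 0 := by linarith
  have : 1 - p ^ z ≠ 0 := by linarith
  field_simp

lemma qGamma_one (p : ℝ) (h0 : 0 < p) (h1 : p < 1) : qGammaF p 1 = 1 := by
  unfold qGammaF
  have := pochInf_pos p p h0 h1 h1
  simp [this.ne']

lemma poch_conv (p a s : ℝ) (h0 : 0 < p) (h1 : p < 1) (ha : 0 < a) (hs0 : 0 ≤ s) (hs1 : s ≤ 1) :
    qPochInf (p ^ a) p ^ (1 - s) * qPochInf (p ^ (a + 1)) p ^ s ≤ qPochInf (p ^ (a + s)) p := by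
  have A := rpow_lt_one' p a h0 h1 ha
  have A0 := Real.rpow_pos_of_pos h0 a
  have B := rpow_lt_one' p (a + 1) h0 h1 (by linarith)
  have pA := pochInf_pos _ p h0 h1 A
  have pB := pochInf_pos _ p h0 h1 B
  have t1 := (tendsto_poch (p ^ a) p h0 h1).rpow_const (p := 1 - s) (Or.inl pA.ne')
  have t2 := (tendsto_poch (p ^ (a + 1)) p h0 h1).rpow_const (p := s) (Or.inl pB.ne')
  refine le_of_tendsto_of_tendsto' (t1.mul t2) (tendsto_poch (p ^ (a + s)) p h0 h1) ?_
  intro n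
  have hk1 : ∀ k : ℕ, 0 ≤ 1 - p ^ a * p ^ k := by
    intro k
    have h2 : p ^ k ≤ 1 := pow_le_one₀ h0.le h1.le
    have h3 : 0 < p ^ k := pow_pos h0 k
    nlinarith
  have hk2 : ∀ k : ℕ, 0 ≤ 1 - p ^ (a + 1) * p ^ k := by
    intro k
    have h2 : p ^ k ≤ 1 := pow_le_one₀ h0.le h1.le
    have h3 : 0 < p ^ k := pow_pos h0 k
    nlinarith
  rw [← Real.finsetProd_rpow _ _ (fun i _ => hk1 i), ← Real.finsetProd_rpow _ _ (fun i _ => hk2 i),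
    ← Finset.prod_mul_distrib]
  refine Finset.prod_le_prod (fun i _ => mul_nonneg (Real.rpow_nonneg (hk1 i) _)
    (Real.rpow_nonneg (hk2 i) _)) ?_
  intro k _
  have e1 := Real.geom_mean_le_arith_mean2_weighted (by linarith : 0 ≤ 1 - s) hs0 (hk1 k) (hk2 k)
    (by ring)
  have e2 := Real.geom_mean_le_arith_mean2_weighted (by linarith : 0 ≤ 1 - s) hs0 zero_le_one
    h0.le (by ring)
  rw [Real.one_rpow] at e2
  refine e1.trans ?_
  rw [Real.rpow_add h0, Real.rpow_add h0, Real.rpow_one]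
  have h3 : 0 < p ^ a * p ^ k := mul_pos A0 (pow_pos h0 k)
  nlinarith [mul_le_mul_of_nonneg_left e2 h3.le]

lemma qGamma_conv (p a s : ℝ) (h0 : 0 < p) (h1 : p < 1) (ha : 0 < a) (hs0 : 0 ≤ s) (hs1 : s ≤ 1) :
    qGammaF p (a + s) ≤ qGammaF p a * qNumber p a ^ s := by
  have h := poch_conv p a s h0 h1 ha hs0 hs1
  have A := rpow_lt_one' p a h0 h1 ha
  have B := rpow_lt_one' p (a + 1) h0 h1 (by linarith)
  have C := rpow_lt_one' p (a + s) h0 h1 (by linarith)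
  have pA := pochInf_pos _ p h0 h1 A
  have pB := pochInf_pos _ p h0 h1 B
  have pC := pochInf_pos _ p h0 h1 C
  have pp := pochInf_pos p p h0 h1 h1
  have e := pochInf_step (p ^ a) p h0 h1
  rw [show p ^ a * p = p ^ (a + 1) by rw [Real.rpow_add h0, Real.rpow_one]] at e
  have eB : qPochInf (p ^ (a + 1)) p = qPochInf (p ^ a) p / (1 - p ^ a) := by
    rw [e]; field_simp [show 1 - p ^ a ≠ 0 by linarith]
  rw [eB, Real.div_rpow pA.le (by linarith), mul_div_assoc', ← Real.rpow_add pA,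
    sub_add_cancel, Real.rpow_one] at h
  have hs := Real.rpow_pos_of_pos (sub_pos.2 A) s
  have h1p := Real.rpow_pos_of_pos (sub_pos.2 h1) (1 - a)
  unfold qGammaF qNumber
  rw [Real.div_rpow (by linarith) (by linarith),
    show 1 - (a + s) = (1 - a) - s by ring, Real.rpow_sub (sub_pos.2 h1)]
  have hs' := Real.rpow_pos_of_pos (sub_pos.2 h1) s
  rw [div_le_iff₀ hs] at h
  have key : qPochInf p p / qPochInf (p ^ (a + s)) p ≤ qPochInf p p / qPochInf (p ^ a) p * (1 - p ^ a) ^ s := by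
    rw [div_mul_eq_mul_div, div_le_div_iff₀ pC pA]
    nlinarith
  calc _ ≤ qPochInf p p / qPochInf (p ^ a) p * (1 - p ^ a) ^ s * ((1 - p) ^ (1 - a) / (1 - p) ^ s) := by
        gcongr
    _ = _ := by ring

lemma qGamma_shift (p z : ℝ) (h0 : 0 < p) (h1 : p < 1) (hz : 0 < z) (N : ℕ) :
    qGammaF p (z + N) = (∏ k ∈ Finset.range N, qNumber p (z + k)) * qGammaF p z := by
  induction N with
  | zero => simp
  | succ N ih =>
    rw [Finset.prod_range_succ, Nat.cast_succ, ← add_assoc, qGamma_step p _ h0 h1 (by positivity), ih]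
    ring

lemma qGamma_nat (p : ℝ) (h0 : 0 < p) (h1 : p < 1) (N : ℕ) :
    qGammaF p ((N : ℝ) + 1) = ∏ k ∈ Finset.range N, qNumber p (1 + k) := by
  rw [add_comm, qGamma_shift p 1 h0 h1 one_pos, qGamma_one p h0 h1, mul_one]

lemma tendsto_id_within : Tendsto (fun q : ℝ => q) (nhdsWithin 1 (Set.Ioo 0 1)) (nhds 1) :=
  tendsto_nhdsWithin_of_tendsto_nhds tendsto_id

lemma ev_Ioo : ∀ᶠ q : ℝ in nhdsWithin 1 (Set.Ioo 0 1), q ∈ Set.Ioo (0 : ℝ) 1 :=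
  self_mem_nhdsWithin

lemma tendsto_qNumber (z : ℝ) :
    Tendsto (fun p => qNumber p z) (nhdsWithin 1 (Set.Ioo 0 1)) (nhds z) := by
  have h := Real.hasDerivAt_rpow_const (x := 1) (p := z) (Or.inl one_ne_zero)
  rw [hasDerivAt_iff_tendsto_slope] at h
  have h' := h.mono_left (nhdsWithin_mono (1 : ℝ) (s := Set.Ioo 0 1) (t := {1}ᶜ)
    (fun q hq => by simpa using hq.2.ne))
  simp only [Real.one_rpow, mul_one] at h'
  refine h'.congr' ?_
  filter_upwards [ev_Ioo] with q hq
  rw [slope_def_field, Real.one_rpow]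
  unfold qNumber
  rw [← neg_sub, ← neg_sub 1 q, neg_div_neg_eq]

lemma tendsto_qGamma_base (s : ℝ) (hs0 : 0 < s) (hs1 : s ≤ 1) :
    Tendsto (fun p => qGammaF p s) (nhdsWithin 1 (Set.Ioo 0 1)) (nhds (Real.Gamma s)) := by
  have hprod : ∀ (z : ℝ) (N : ℕ), Tendsto (fun p => ∏ k ∈ Finset.range N, qNumber p (z + k))
      (nhdsWithin 1 (Set.Ioo 0 1)) (nhds (∏ k ∈ Finset.range N, (z + k))) := fun z N =>
    tendsto_finsetProd _ (fun k _ => tendsto_qNumber _)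
  have hpos : ∀ N : ℕ, 0 < ∏ k ∈ Finset.range N, (s + k) := fun N =>
    Finset.prod_pos (fun k _ => by positivity)
  have hfac : ∀ N : ℕ, ∏ k ∈ Finset.range N, ((1 : ℝ) + k) = (Nat.factorial N : ℝ) := by
    intro N
    induction N with
    | zero => simp
    | succ N ih => rw [Finset.prod_range_succ, ih, Nat.factorial_succ]; push_cast; ring
  have U : ∀ M : ℕ, ∀ p ∈ Set.Ioo (0 : ℝ) 1, qGammaF p s ≤
      (∏ k ∈ Finset.range M, qNumber p (1 + k)) * qNumber p ((M : ℝ) + 1) ^ s /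
        ∏ k ∈ Finset.range (M + 1), qNumber p (s + k) := by
    intro M p hp
    have h1 := qGamma_conv p (M + 1) s hp.1 hp.2 (by positivity) hs0.le hs1
    have h2 := qGamma_shift p s hp.1 hp.2 hs0 (M + 1)
    rw [le_div_iff₀ (Finset.prod_pos fun k _ => qNumber_pos p _ hp.1 hp.2 (by positivity)),
      ← qGamma_nat p hp.1 hp.2, mul_comm, ← h2]
    refine le_trans (le_of_eq ?_) h1
    congr 1; push_cast; ring
  have L : ∀ M : ℕ, ∀ p ∈ Set.Ioo (0 : ℝ) 1,
      (∏ k ∈ Finset.range (M + 1), qNumber p (1 + k)) / qNumber p (s + (M + 1 : ℕ)) ^ (1 - s) /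
        (∏ k ∈ Finset.range (M + 1), qNumber p (s + k)) ≤ qGammaF p s := by
    intro M p hp
    have h1 := qGamma_conv p (s + (M + 1 : ℕ)) (1 - s) hp.1 hp.2 (by positivity) (by linarith) (by linarith)
    have h2 := qGamma_shift p s hp.1 hp.2 hs0 (M + 1)
    rw [div_le_iff₀ (Finset.prod_pos fun k _ => qNumber_pos p _ hp.1 hp.2 (by positivity)),
      div_le_iff₀ (Real.rpow_pos_of_pos (qNumber_pos p _ hp.1 hp.2 (by positivity)) _),
      ← qGamma_nat p hp.1 hp.2, mul_comm (qGammaF p s), ← h2]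
    refine le_trans (le_of_eq ?_) h1
    congr 1; push_cast; ring
  have U' : ∀ M : ℕ, Tendsto (fun p => (∏ k ∈ Finset.range M, qNumber p (1 + k)) * qNumber p ((M : ℝ) + 1) ^ s /
        ∏ k ∈ Finset.range (M + 1), qNumber p (s + k)) (nhdsWithin 1 (Set.Ioo 0 1))
      (nhds ((Nat.factorial M : ℝ) * ((M : ℝ) + 1) ^ s / ∏ k ∈ Finset.range (M + 1), (s + k))) := by
    intro M
    rw [← hfac]
    exact ((hprod 1 M).mul ((tendsto_qNumber _).rpow_const (Or.inl (by positivity)))).div (hprod s _)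
      (hpos _).ne'
  have L' : ∀ M : ℕ, Tendsto (fun p => (∏ k ∈ Finset.range (M + 1), qNumber p (1 + k)) / qNumber p (s + (M + 1 : ℕ)) ^ (1 - s) /
        (∏ k ∈ Finset.range (M + 1), qNumber p (s + k))) (nhdsWithin 1 (Set.Ioo 0 1))
      (nhds ((Nat.factorial (M + 1) : ℝ) / (s + (M + 1 : ℕ)) ^ (1 - s) / ∏ k ∈ Finset.range (M + 1), (s + k))) := by
    intro M
    rw [← hfac]
    have hp : (0 : ℝ) < (s + (M + 1 : ℕ)) := by positivity
    exact ((hprod 1 (M + 1)).div ((tendsto_qNumber _).rpow_const (Or.inl hp.ne'))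
      (Real.rpow_pos_of_pos hp _).ne').div (hprod s _) (hpos _).ne'
  have G := (Real.GammaSeq_tendsto_Gamma s).comp (tendsto_add_atTop_nat 1)
  have r : Tendsto (fun M : ℕ => 1 + s / ((M + 1 : ℕ) : ℝ)) atTop (nhds 1) := by
    have := (tendsto_const_div_atTop_nhds_zero_nat s).comp (tendsto_add_atTop_nat 1)
    simpa using this.const_add 1
  have U'' : Tendsto (fun M : ℕ => (Nat.factorial M : ℝ) * ((M : ℝ) + 1) ^ s / ∏ k ∈ Finset.range (M + 1), (s + k)) atTop
      (nhds (Real.Gamma s)) := by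
    have h := G.mul r
    rw [mul_one] at h
    refine h.congr ?_
    intro M
    simp only [Function.comp, Real.GammaSeq]
    rw [Finset.prod_range_succ _ (M + 1), Nat.factorial_succ]
    have := (hpos (M + 1)).ne'
    push_cast
    field_simp
    ring
  have L'' : Tendsto (fun M : ℕ => (Nat.factorial (M + 1) : ℝ) / (s + (M + 1 : ℕ)) ^ (1 - s) / ∏ k ∈ Finset.range (M + 1), (s + k)) atTop
      (nhds (Real.Gamma s)) := by
    have h := G.mul (r.rpow_const (p := s) (Or.inl one_ne_zero))
    rw [Real.one_rpow, mul_one] at h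
    refine h.congr ?_
    intro M
    simp only [Function.comp, Real.GammaSeq]
    rw [Finset.prod_range_succ _ (M + 1)]
    have := (hpos (M + 1)).ne'
    have hM : (0 : ℝ) < ((M + 1 : ℕ) : ℝ) := by positivity
    have hp : (0 : ℝ) < (s + (M + 1 : ℕ)) := by positivity
    rw [show 1 + s / ((M + 1 : ℕ) : ℝ) = (s + (M + 1 : ℕ)) / (M + 1 : ℕ) by field_simp; ring,
      Real.div_rpow hp.le hM.le, Real.rpow_sub hp, Real.rpow_one]
    have := (Real.rpow_pos_of_pos hp s).ne'
    have := (Real.rpow_pos_of_pos hM s).ne'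
    field_simp
  rw [tendsto_order]
  constructor
  · intro c hc
    obtain ⟨M, hM⟩ := (L''.eventually (lt_mem_nhds hc)).exists
    filter_upwards [(L' M).eventually (lt_mem_nhds hM), ev_Ioo] with p h1 h2
    exact h1.trans_le (L M p h2)
  · intro c hc
    obtain ⟨M, hM⟩ := (U''.eventually (gt_mem_nhds hc)).exists
    filter_upwards [(U' M).eventually (gt_mem_nhds hM), ev_Ioo] with p h1 h2
    exact (U M p h2).trans_lt h1

lemma tendsto_qGamma (z : ℝ) (hz : 0 < z) :
    Tendsto (fun p => qGammaF p z) (nhdsWithin 1 (Set.Ioo 0 1)) (nhds (Real.Gamma z)) := by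
  have key : ∀ M : ℕ, ∀ s : ℝ, 0 < s → s ≤ M + 1 →
      Tendsto (fun p => qGammaF p s) (nhdsWithin 1 (Set.Ioo 0 1)) (nhds (Real.Gamma s)) := by
    intro M
    induction M with
    | zero => intro s h0 h1; exact tendsto_qGamma_base s h0 (by simpa using h1)
    | succ M ih =>
      intro s h0 h1
      by_cases hs : s ≤ 1
      · exact tendsto_qGamma_base s h0 hs
      · have h2 : 0 < s - 1 := by linarith
        have h := (tendsto_qNumber (s - 1)).mul (ih (s - 1) h2 (by push_cast at h1; linarith))
        rw [← Real.Gamma_add_one h2.ne', sub_add_cancel] at h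
        refine h.congr' ?_
        filter_upwards [ev_Ioo] with p hp
        rw [← qGamma_step p _ hp.1 hp.2 h2, sub_add_cancel]
  obtain ⟨M, hM⟩ := exists_nat_ge z
  exact key M z hz (by linarith)

lemma one_add_ge_exp (u : ℝ) (hu : 0 ≤ u) : Real.exp (u - u ^ 2) ≤ 1 + u := by
  have h1 : 0 < 1 + u := by linarith
  have h := Real.one_sub_inv_le_log_of_pos h1
  rw [← Real.le_log_iff_exp_le h1]
  refine le_trans ?_ h
  have : 1 - (1 + u)⁻¹ = u / (1 + u) := by field_simp; ring
  rw [this, le_div_iff₀ h1]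
  nlinarith [pow_nonneg hu 3]

lemma prod_bounds (c p : ℝ) (hc : 0 ≤ c) (h0 : 0 < p) (h1 : p < 1) :
    Real.exp (c - c ^ 2 * ((1 - p) / (1 + p))) ≤ qPochInf (-(c * (1 - p))) p ∧
      qPochInf (-(c * (1 - p))) p ≤ Real.exp c := by
  have T := tendsto_poch (-(c * (1 - p))) p h0 h1
  have S1 : HasSum (fun k : ℕ => c * (1 - p) * p ^ k) c := by
    have := (hasSum_geometric_of_lt_one h0.le h1).mul_left (c * (1 - p))
    rwa [mul_assoc, mul_inv_cancel₀ (by linarith), mul_one] at this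
  have S2 : HasSum (fun k : ℕ => (c * (1 - p) * p ^ k) ^ 2) (c ^ 2 * ((1 - p) / (1 + p))) := by
    have := (hasSum_geometric_of_lt_one (r := p ^ 2) (by positivity) (by nlinarith)).mul_left
      ((c * (1 - p)) ^ 2)
    have e : c ^ 2 * ((1 - p) / (1 + p)) = (c * (1 - p)) ^ 2 * (1 - p ^ 2)⁻¹ := by
      have h2 : 1 - p ≠ 0 := by linarith
      have h3 : 1 - p ^ 2 = (1 - p) * (1 + p) := by ring
      rw [h3]
      field_simp
    rw [e]
    refine this.congr_fun ?_
    intro k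
    ring
  have hu : ∀ k : ℕ, 0 ≤ c * (1 - p) * p ^ k := fun k =>
    mul_nonneg (mul_nonneg hc (by linarith)) (by positivity)
  constructor
  · refine le_of_tendsto_of_tendsto' ((Real.continuous_exp.tendsto _).comp
      (S1.sub S2).tendsto_sum_nat) T ?_
    intro n
    simp only [Function.comp, Real.exp_sum]
    refine Finset.prod_le_prod (fun k _ => (Real.exp_pos _).le) (fun k _ => ?_)
    refine (one_add_ge_exp _ (hu k)).trans (le_of_eq ?_)
    ring
  · refine le_of_tendsto_of_tendsto' T ((Real.continuous_exp.tendsto _).comp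
      S1.tendsto_sum_nat) ?_
    intro n
    simp only [Function.comp, Real.exp_sum]
    refine Finset.prod_le_prod (fun k _ => by have := hu k; linarith) (fun k _ => ?_)
    have := Real.add_one_le_exp (c * (1 - p) * p ^ k)
    linarith

lemma omega_eq (q α x : ℝ) :
    omegaAlpha q α x = (qPochInf (-(q ^ (-(2 * α + 1)) * x ^ 2)) (q ^ 2))⁻¹ := by
  unfold omegaAlpha qPochInf
  congr 2
  ext k
  rw [pow_mul]
  ring

lemma tendsto_rpow_one (z : ℝ) :
    Tendsto (fun q : ℝ => q ^ z) (nhdsWithin 1 (Set.Ioo 0 1)) (nhds 1) := by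
  have := tendsto_id_within.rpow_const (p := z) (Or.inl one_ne_zero)
  rwa [Real.one_rpow] at this

lemma tendsto_omega (α x : ℝ) :
    Tendsto (fun q => omegaAlpha q α (Real.sqrt (1 - q ^ 2) * x)) (nhdsWithin 1 (Set.Ioo 0 1))
      (nhds (Real.exp (-x ^ 2))) := by
  have h : Tendsto (fun q : ℝ => qPochInf (-(q ^ (-(2 * α + 1)) * (Real.sqrt (1 - q ^ 2) * x) ^ 2)) (q ^ 2))
      (nhdsWithin 1 (Set.Ioo 0 1)) (nhds (Real.exp (x ^ 2))) := by
    have hc : Tendsto (fun q : ℝ => q ^ (-(2 * α + 1)) * x ^ 2) (nhdsWithin 1 (Set.Ioo 0 1)) (nhds (x ^ 2)) := by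
      simpa using (tendsto_rpow_one (-(2 * α + 1))).mul_const (x ^ 2)
    have hq2 : Tendsto (fun q : ℝ => q ^ 2) (nhdsWithin 1 (Set.Ioo 0 1)) (nhds 1) := by
      simpa using tendsto_id_within.pow 2
    have hr : Tendsto (fun q : ℝ => (1 - q ^ 2) / (1 + q ^ 2)) (nhdsWithin 1 (Set.Ioo 0 1)) (nhds 0) := by
      have := (hq2.const_sub 1).div (hq2.const_add 1) (by norm_num)
      rw [sub_self, zero_div] at this
      exact this
    have hlow := (Real.continuous_exp.tendsto _).comp (hc.sub ((hc.pow 2).mul hr))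
    have hup := (Real.continuous_exp.tendsto _).comp hc
    rw [mul_zero, sub_zero] at hlow
    have e : ∀ q ∈ Set.Ioo (0 : ℝ) 1, q ^ (-(2 * α + 1)) * (Real.sqrt (1 - q ^ 2) * x) ^ 2 =
        q ^ (-(2 * α + 1)) * x ^ 2 * (1 - q ^ 2) := by
      intro q hq
      rw [mul_pow, Real.sq_sqrt (by nlinarith [hq.1, hq.2])]
      ring
    have b : ∀ q ∈ Set.Ioo (0 : ℝ) 1, _ := fun q hq =>
      prod_bounds (q ^ (-(2 * α + 1)) * x ^ 2) (q ^ 2)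
        (mul_nonneg (Real.rpow_nonneg hq.1.le _) (sq_nonneg x)) (pow_pos hq.1 2) (by nlinarith [hq.1, hq.2])
    refine tendsto_of_tendsto_of_tendsto_of_le_of_le' hlow hup ?_ ?_
    · filter_upwards [ev_Ioo] with q hq
      rw [e q hq]
      exact (b q hq).1
    · filter_upwards [ev_Ioo] with q hq
      rw [e q hq]
      exact (b q hq).2
  have := h.inv₀ (Real.exp_pos _).ne'
  rw [← Real.exp_neg] at this
  refine this.congr ?_
  intro q
  rw [omega_eq]

/-- the product of the two theta-type factors -/
def thetaR (q b : ℝ) : ℝ :=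
  qPochInf (-q ^ (1 - 2 * b)) (q ^ 2) * qPochInf (-q ^ (1 + 2 * b)) (q ^ 2)

lemma neg_rpow_lt_one (q z : ℝ) (h0 : 0 < q) : -q ^ z < 1 := by
  have := Real.rpow_pos_of_pos h0 z
  linarith

lemma thetaR_pos (q b : ℝ) (h0 : 0 < q) (h1 : q < 1) : 0 < thetaR q b :=
  mul_pos (pochInf_pos _ _ (by positivity) (by nlinarith) (neg_rpow_lt_one _ _ h0))
    (pochInf_pos _ _ (by positivity) (by nlinarith) (neg_rpow_lt_one _ _ h0))

lemma thetaR_step (q : ℝ) (N : ℝ) (h0 : 0 < q) (h1 : q < 1) :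
    thetaR q (N + 1) = q ^ (-(2 * N + 1)) * thetaR q N := by
  have hq2 : q ^ 2 < 1 := by nlinarith
  have hq0 : 0 < q ^ 2 := by positivity
  unfold thetaR
  rw [pochInf_step (-q ^ (1 - 2 * (N + 1))) (q ^ 2) hq0 hq2,
    pochInf_step (-q ^ (1 + 2 * N)) (q ^ 2) hq0 hq2]
  have e1 : -q ^ (1 - 2 * (N + 1)) * q ^ 2 = -q ^ (1 - 2 * N) := by
    rw [neg_mul, ← Real.rpow_natCast, ← Real.rpow_add h0]
    congr 2; push_cast; ring
  have e2 : -q ^ (1 + 2 * N) * q ^ 2 = -q ^ (1 + 2 * (N + 1)) := by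
    rw [neg_mul, ← Real.rpow_natCast, ← Real.rpow_add h0]
    congr 2; push_cast; ring
  rw [e1, e2]
  have e3 : 1 - -q ^ (1 - 2 * (N + 1)) = q ^ (-(2 * N + 1)) * (1 - -q ^ (1 + 2 * N)) := by
    have : q ^ (-(2 * N + 1)) * q ^ (1 + 2 * N) = 1 := by
      rw [← Real.rpow_add h0]
      rw [show -(2 * N + 1) + (1 + 2 * N) = 0 by ring, Real.rpow_zero]
    rw [show 1 - 2 * (N + 1) = -(2 * N + 1) by ring]
    linarith
  rw [e3]
  ring

lemma thetaR_nat (q : ℝ) (h0 : 0 < q) (h1 : q < 1) (N : ℕ) :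
    thetaR q N = q ^ (-((N : ℝ) ^ 2)) * thetaR q 0 := by
  induction N with
  | zero => simp
  | succ N ih =>
    rw [Nat.cast_succ, thetaR_step q N h0 h1, ih, ← mul_assoc, ← Real.rpow_add h0]
    congr 2
    ring

lemma thetaR_mono (q b c : ℝ) (h0 : 0 < q) (h1 : q < 1) (hb : 0 ≤ b) (hbc : b ≤ c) :
    thetaR q b ≤ thetaR q c := by
  have hq2 : q ^ 2 < 1 := by nlinarith
  have hq0 : 0 < q ^ 2 := by positivity
  unfold thetaR
  refine le_of_tendsto_of_tendsto'
    ((tendsto_poch _ _ hq0 hq2).mul (tendsto_poch _ _ hq0 hq2))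
    ((tendsto_poch _ _ hq0 hq2).mul (tendsto_poch _ _ hq0 hq2)) ?_
  intro n
  rw [← Finset.prod_mul_distrib, ← Finset.prod_mul_distrib]
  have P : ∀ z : ℝ, 0 < q ^ z := fun z => Real.rpow_pos_of_pos h0 z
  refine Finset.prod_le_prod (fun k _ => ?_) (fun k _ => ?_)
  · have := P (1 - 2 * b); have := P (1 + 2 * b)
    have : 0 < (q ^ 2) ^ k := by positivity
    simp only [neg_mul, sub_neg_eq_add]
    positivity
  · have hk : 0 < (q ^ 2) ^ k := by positivity
    set t := (q ^ 2) ^ k with ht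
    have eb : q ^ (1 - 2 * b) * q ^ (1 + 2 * b) = q ^ 2 := by
      rw [← Real.rpow_add h0, ← Real.rpow_natCast]; congr 1; push_cast; ring
    have ec : q ^ (1 - 2 * c) * q ^ (1 + 2 * c) = q ^ 2 := by
      rw [← Real.rpow_add h0, ← Real.rpow_natCast]; congr 1; push_cast; ring
    have key : q ^ (1 - 2 * b) + q ^ (1 + 2 * b) ≤ q ^ (1 - 2 * c) + q ^ (1 + 2 * c) := by
      have m1 : q ^ (1 - 2 * b) ≤ q ^ (1 - 2 * c) :=
        Real.rpow_le_rpow_of_exponent_ge h0 h1.le (by linarith)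
      have m2 : q ^ (1 + 2 * b) ≤ q ^ (1 - 2 * c) * 1 := by
        rw [mul_one]
        exact Real.rpow_le_rpow_of_exponent_ge h0 h1.le (by linarith)
      have := P (1 - 2 * c)
      have h5 : 0 ≤ (q ^ (1 - 2 * c) - q ^ (1 - 2 * b)) * (q ^ (1 - 2 * c) - q ^ (1 + 2 * b)) :=
        mul_nonneg (by linarith) (by linarith)
      have h6 : 0 ≤ q ^ (1 - 2 * c) * (q ^ (1 - 2 * c) + q ^ (1 + 2 * c) - q ^ (1 - 2 * b) - q ^ (1 + 2 * b)) := by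
        nlinarith
      have := nonneg_of_mul_nonneg_right h6 this
      linarith
    have l1 : (1 - -q ^ (1 - 2 * b) * t) * (1 - -q ^ (1 + 2 * b) * t) =
        1 + (q ^ (1 - 2 * b) + q ^ (1 + 2 * b)) * t + q ^ 2 * t ^ 2 := by
      rw [← eb]; ring
    have l2 : (1 - -q ^ (1 - 2 * c) * t) * (1 - -q ^ (1 + 2 * c) * t) =
        1 + (q ^ (1 - 2 * c) + q ^ (1 + 2 * c)) * t + q ^ 2 * t ^ 2 := by
      rw [← ec]; ring
    rw [l1, l2]
    linarith [mul_le_mul_of_nonneg_right key hk.le]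

lemma tendsto_thetaR (b : ℝ) (hb : 0 ≤ b) :
    Tendsto (fun q => thetaR q b / thetaR q 0) (nhdsWithin 1 (Set.Ioo 0 1)) (nhds 1) := by
  obtain ⟨N, hN⟩ := exists_nat_ge b
  refine tendsto_of_tendsto_of_tendsto_of_le_of_le' tendsto_const_nhds
    (tendsto_rpow_one (-((N : ℝ) ^ 2))) ?_ ?_
  · filter_upwards [ev_Ioo] with q hq
    rw [le_div_iff₀ (thetaR_pos q 0 hq.1 hq.2), one_mul]
    exact thetaR_mono q 0 b hq.1 hq.2 le_rfl hb
  · filter_upwards [ev_Ioo] with q hq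
    rw [div_le_iff₀ (thetaR_pos q 0 hq.1 hq.2), ← thetaR_nat q hq.1 hq.2]
    exact thetaR_mono q b N hq.1 hq.2 hb hN

lemma tendsto_sq_within :
    Tendsto (fun q : ℝ => q ^ 2) (nhdsWithin 1 (Set.Ioo 0 1)) (nhdsWithin 1 (Set.Ioo 0 1)) := by
  refine tendsto_nhdsWithin_iff.2 ⟨?_, ?_⟩
  · simpa using tendsto_id_within.pow 2
  · filter_upwards [ev_Ioo] with q hq
    exact ⟨pow_pos hq.1 2, by nlinarith [hq.1, hq.2]⟩

lemma tendsto_cAlpha (α : ℝ) (hα : -1 < α) :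
    Tendsto (fun q : ℝ => (1 - q ^ 2) ^ ((α + 1) / 2) * cAlpha q α) (nhdsWithin 1 (Set.Ioo 0 1))
      (nhds (Real.sqrt (1 / Real.Gamma (α + 1)))) := by
  have hz : 0 < α + 1 := by linarith
  have h1 := tendsto_thetaR (α + 1) hz.le
  have h2 := (tendsto_qGamma (α + 1) hz).comp tendsto_sq_within
  have h3 : Tendsto (fun q : ℝ => (1 + q) / 2) (nhdsWithin 1 (Set.Ioo 0 1)) (nhds 1) := by
    have := (tendsto_id_within.const_add 1).div_const 2
    rwa [show ((1 : ℝ) + 1) / 2 = 1 by norm_num] at this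
  have h4 := ((h3.mul h1).div h2 (Real.Gamma_pos_of_pos hz).ne').sqrt
  rw [one_mul] at h4
  refine h4.congr' ?_
  filter_upwards [ev_Ioo] with q hq
  have hq1 : 0 < 1 - q := by linarith [hq.2]
  have hq2 : 0 < 1 - q ^ 2 := by nlinarith [hq.1, hq.2]
  have e0 : (1 - q ^ 2) ^ ((α + 1) / 2) = Real.sqrt ((1 - q ^ 2) ^ (α + 1)) := by
    rw [Real.sqrt_eq_rpow, ← Real.rpow_mul hq2.le]
    congr 1; ring
  unfold cAlpha
  rw [e0, ← Real.sqrt_mul (Real.rpow_nonneg hq2.le _)]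
  congr 1
  simp only [Pi.div_apply, Function.comp, thetaR, qGammaF]
  have e1 : (1 : ℝ) - 2 * (α + 1) = -(2 * α + 1) := by ring
  have e2 : (1 : ℝ) + 2 * (α + 1) = 2 * α + 3 := by ring
  have e3 : (q ^ 2) ^ (α + 1) = q ^ (2 * α + 2) := by
    rw [← Real.rpow_natCast, ← Real.rpow_mul hq.1.le]
    congr 1; push_cast; ring
  have e4 : (1 : ℝ) - (α + 1) = -α := by ring
  rw [e1, e2, e3, e4, Real.rpow_neg hq2.le, Real.rpow_add_one hq2.ne']
  simp only [mul_zero, sub_zero, add_zero, Real.rpow_one]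
  have p0 : 0 < q ^ 2 := pow_pos hq.1 2
  have p1 : q ^ 2 < 1 := by linarith
  have a1 := (pochInf_pos (-q) (q ^ 2) p0 p1 (by linarith [hq.1])).ne'
  have a2 := (pochInf_pos (q ^ 2) (q ^ 2) p0 p1 p1).ne'
  have a3 := (pochInf_pos (q ^ (2 * α + 2)) (q ^ 2) p0 p1
    (rpow_lt_one' _ _ hq.1 hq.2 (by linarith))).ne'
  have a4 := (Real.rpow_pos_of_pos hq2 α).ne'
  have a5 := hq1.ne'
  field_simp
  ring

/-- the classical limit of the generalized q-integers -/
def numL (α : ℝ) (m : ℕ) : ℝ := m + (α + 1 / 2) * (1 - (-1) ^ m)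

lemma tendsto_qNumAlpha (α : ℝ) (m : ℕ) :
    Tendsto (fun q => qNumAlpha q α m) (nhdsWithin 1 (Set.Ioo 0 1)) (nhds (numL α m)) := by
  unfold qNumAlpha numL
  rcases Nat.even_or_odd m with h | h
  · simp only [Nat.even_iff.1 h, if_true, h.neg_one_pow, sub_self, mul_zero, add_zero]
    exact tendsto_qNumber _
  · have h2 : ¬ (m % 2 = 0) := by rw [Nat.odd_iff.1 h]; norm_num
    simp only [h2, if_false, h.neg_one_pow]
    convert tendsto_qNumber ((m : ℝ) + 2 * α + 1) using 2
    ring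

lemma gammaGen_step (α : ℝ) (hα : -1 < α) (n : ℕ) :
    gammaGen (α + 1 / 2) (n + 1) = numL α (n + 1) * gammaGen (α + 1 / 2) n := by
  unfold gammaGen numL
  rcases Nat.even_or_odd' n with ⟨m, h | h⟩
  · have a1 : (n + 1) / 2 = m := by omega
    have a2 : (n + 1 + 1) / 2 = m + 1 := by omega
    have a3 : n / 2 = m := by omega
    have o : Odd (n + 1) := ⟨m, by omega⟩
    rw [a1, a2, a3, o.neg_one_pow, h]
    have hp : α + 1 / 2 + (m : ℝ) + 1 / 2 ≠ 0 := by
      have : (0 : ℝ) ≤ m := by positivity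
      linarith
    rw [show α + 1 / 2 + ((m + 1 : ℕ) : ℝ) + 1 / 2 = (α + 1 / 2 + (m : ℝ) + 1 / 2) + 1 by
      push_cast; ring, Real.Gamma_add_one hp]
    push_cast
    ring
  · have a1 : (n + 1) / 2 = m + 1 := by omega
    have a2 : (n + 1 + 1) / 2 = m + 1 := by omega
    have a3 : n / 2 = m := by omega
    have o : Even (n + 1) := ⟨m + 1, by omega⟩
    rw [a1, a2, a3, o.neg_one_pow, h, Nat.factorial_succ]
    push_cast
    ring

lemma gammaGen_eq (α : ℝ) (hα : -1 < α) (n : ℕ) :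
    gammaGen (α + 1 / 2) n = ∏ k ∈ Finset.range n, numL α (k + 1) := by
  induction n with
  | zero =>
    unfold gammaGen
    have := Real.Gamma_pos_of_pos (show 0 < α + 1 / 2 + 1 / 2 by linarith)
    simp
    simpa using this.ne'
  | succ n ih => rw [gammaGen_step α hα, ih, Finset.prod_range_succ, mul_comm]

lemma gammaGen_pos (α : ℝ) (hα : -1 < α) (n : ℕ) : 0 < gammaGen (α + 1 / 2) n := by
  unfold gammaGen
  have h1 := Real.Gamma_pos_of_pos (show 0 < α + 1 / 2 + 1 / 2 by linarith)
  have h2 := Real.Gamma_pos_of_pos (show 0 < α + 1 / 2 + (((n + 1) / 2 : ℕ) : ℝ) + 1 / 2 by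
    have : (0 : ℝ) ≤ (((n + 1) / 2 : ℕ) : ℝ) := by positivity
    linarith)
  positivity

lemma tendsto_qFactAlpha (α : ℝ) (hα : -1 < α) (n : ℕ) :
    Tendsto (fun q => qFactAlpha q α n) (nhdsWithin 1 (Set.Ioo 0 1))
      (nhds (gammaGen (α + 1 / 2) n)) := by
  rw [gammaGen_eq α hα]
  exact tendsto_finsetProd _ (fun k _ => tendsto_qNumAlpha α (k + 1))

lemma qFactAlpha_pos (q α : ℝ) (hα : -1 < α) (h0 : 0 < q) (h1 : q < 1) (n : ℕ) :
    0 < qFactAlpha q α n := by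
  refine Finset.prod_pos (fun k _ => ?_)
  unfold qNumAlpha
  have : (0 : ℝ) ≤ k := by positivity
  split_ifs
  · exact qNumber_pos q _ h0 h1 (by positivity)
  · exact qNumber_pos q _ h0 h1 (by push_cast; linarith)

/-- the finite q-factorial in base p -/
def qFac (p : ℝ) (k : ℕ) : ℝ := ∏ j ∈ Finset.range k, qNumber p ((j : ℝ) + 1)

lemma qPoch_eq_qFac (p : ℝ) (h0 : 0 < p) (h1 : p < 1) (k : ℕ) :
    qPoch p p k = (1 - p) ^ k * qFac p k := by
  unfold qPoch qFac
  rw [← Finset.card_range k, ← Finset.prod_const, Finset.card_range, ← Finset.prod_mul_distrib]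
  refine Finset.prod_congr rfl (fun j _ => ?_)
  unfold qNumber
  rw [mul_div_cancel₀ _ (by linarith), Real.rpow_add_one h0.ne', Real.rpow_natCast]
  ring

lemma qFac_pos (p : ℝ) (h0 : 0 < p) (h1 : p < 1) (k : ℕ) : 0 < qFac p k :=
  Finset.prod_pos (fun j _ => qNumber_pos p _ h0 h1 (by positivity))

lemma tendsto_qFac (k : ℕ) :
    Tendsto (fun p => qFac p k) (nhdsWithin 1 (Set.Ioo 0 1)) (nhds (Nat.factorial k : ℝ)) := by
  have h : ∏ j ∈ Finset.range k, ((j : ℝ) + 1) = (Nat.factorial k : ℝ) := by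
    induction k with
    | zero => simp
    | succ N ih => rw [Finset.prod_range_succ, ih, Nat.factorial_succ]; push_cast; ring
  rw [← h]
  exact tendsto_finsetProd _ (fun k _ => tendsto_qNumber _)

/-- terms of the rescaled finite sum -/
def qTerm (α x : ℝ) (n k : ℕ) (q : ℝ) : ℝ :=
  (-1 : ℝ) ^ k * q ^ ((k * (2 * k + 1) : ℤ) - (2 * n * k : ℤ)) * (q ^ (n - 2 * k))⁻¹ *
    (Real.sqrt (1 + q) ^ (n - 2 * k) / ((1 + q) ^ k * Real.sqrt (1 + q))) *
    (x ^ (n - 2 * k) / x) * qNumAlpha q α (n - 2 * k) / (qFac (q ^ 2) k * qFactAlpha q α (n - 2 * k))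

lemma tendsto_term (α x : ℝ) (hα : -1 < α) (n k : ℕ) :
    Tendsto (qTerm α x n k) (nhdsWithin 1 (Set.Ioo 0 1))
      (nhds ((-1 : ℝ) ^ k * (Real.sqrt 2 ^ (n - 2 * k) / (2 ^ k * Real.sqrt 2)) *
        (x ^ (n - 2 * k) / x) * numL α (n - 2 * k) /
          ((Nat.factorial k : ℝ) * gammaGen (α + 1 / 2) (n - 2 * k)))) := by
  have h1 : Tendsto (fun q : ℝ => 1 + q) (nhdsWithin 1 (Set.Ioo 0 1)) (nhds 2) := by
    have := tendsto_id_within.const_add 1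
    rwa [show (1 : ℝ) + 1 = 2 by norm_num] at this
  have hs := h1.sqrt
  have hz : Tendsto (fun q : ℝ => q ^ ((k * (2 * k + 1) : ℤ) - (2 * n * k : ℤ)))
      (nhdsWithin 1 (Set.Ioo 0 1)) (nhds 1) := by
    have := tendsto_id_within.zpow₀ ((k * (2 * k + 1) : ℤ) - (2 * n * k : ℤ)) (Or.inl one_ne_zero)
    rwa [one_zpow] at this
  have hi : Tendsto (fun q : ℝ => (q ^ (n - 2 * k))⁻¹)
      (nhdsWithin 1 (Set.Ioo 0 1)) (nhds 1) := by
    have := (tendsto_id_within.pow (n - 2 * k)).inv₀ (by simp)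
    rwa [one_pow, inv_one] at this
  have hv : Tendsto (fun q : ℝ => Real.sqrt (1 + q) ^ (n - 2 * k) / ((1 + q) ^ k * Real.sqrt (1 + q)))
      (nhdsWithin 1 (Set.Ioo 0 1)) (nhds (Real.sqrt 2 ^ (n - 2 * k) / (2 ^ k * Real.sqrt 2))) :=
    (hs.pow _).div ((h1.pow k).mul hs) (by positivity)
  have hd := ((tendsto_qFac k).comp tendsto_sq_within).mul (tendsto_qFactAlpha α hα (n - 2 * k))
  have hne : (Nat.factorial k : ℝ) * gammaGen (α + 1 / 2) (n - 2 * k) ≠ 0 := by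
    have := gammaGen_pos α hα (n - 2 * k)
    positivity
  have := (((((hz.const_mul ((-1 : ℝ) ^ k)).mul hi).mul hv).mul_const (x ^ (n - 2 * k) / x)).mul
    (tendsto_qNumAlpha α (n - 2 * k))).div hd hne
  rw [mul_one, mul_one] at this
  exact this

lemma theta_qnum (q α : ℝ) (h0 : 0 < q) (h1 : q < 1) (n k : ℕ) (hk : 2 * k ≤ n) :
    (q ^ (n - 2 * k))⁻¹ - q ^ ((2 * α + 1) * theta n) =
      (q ^ (n - 2 * k))⁻¹ * ((1 - q) * qNumAlpha q α (n - 2 * k)) := by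
  have hq : (1 - q) ≠ 0 := by linarith
  have hqm : q ^ (n - 2 * k) ≠ 0 := by positivity
  unfold qNumAlpha qNumber theta
  by_cases h : n % 2 = 1
  · have h2 : ¬ ((n - 2 * k) % 2 = 0) := by omega
    simp only [h, h2, if_true, if_false, mul_one]
    rw [mul_div_cancel₀ _ hq, add_assoc, Real.rpow_add h0 ((n - 2 * k : ℕ) : ℝ), Real.rpow_natCast]
    field_simp
  · have h2 : ((n - 2 * k) % 2 = 0) := by omega
    simp only [h, h2, if_true, if_false, mul_zero, Real.rpow_zero]
    rw [mul_div_cancel₀ _ hq, Real.rpow_natCast]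
    field_simp

lemma omega_shift (q α y : ℝ) (h0 : 0 < q) (h1 : q < 1) :
    Real.sqrt (1 + q ^ (-(2 * α + 3)) * y ^ 2) * Real.sqrt (omegaAlpha q α (y / q)) =
      Real.sqrt (omegaAlpha q α y) := by
  have hq2 : q ^ 2 < 1 := by nlinarith
  have hq0 : 0 < q ^ 2 := by positivity
  have hp : 0 < q ^ (-(2 * α + 3)) := Real.rpow_pos_of_pos h0 _
  have hpos : 0 < 1 + q ^ (-(2 * α + 3)) * y ^ 2 := by positivity
  rw [← Real.sqrt_mul hpos.le]
  congr 1
  have e : q ^ (-(2 * α + 1)) = q ^ (-(2 * α + 3)) * q ^ 2 := by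
    rw [← Real.rpow_natCast, ← Real.rpow_add h0]; congr 1; push_cast; ring
  rw [omega_eq, omega_eq, pochInf_step (-(q ^ (-(2 * α + 1)) * (y / q) ^ 2)) _ hq0 hq2]
  have e1 : -(q ^ (-(2 * α + 1)) * (y / q) ^ 2) = -(q ^ (-(2 * α + 3)) * y ^ 2) := by
    rw [e]; field_simp
  have e2 : -(q ^ (-(2 * α + 3)) * y ^ 2) * q ^ 2 = -(q ^ (-(2 * α + 1)) * y ^ 2) := by
    rw [e]; ring
  rw [e1, e2, sub_neg_eq_add, mul_inv, ← mul_assoc, mul_inv_cancel₀ hpos.ne', one_mul]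

lemma term_id (q α x : ℝ) (hα : -1 < α) (h0 : 0 < q) (h1 : q < 1) (hx : x ≠ 0) (n k : ℕ)
    (hk : 2 * k ≤ n) :
    1 / (Real.sqrt (1 - q) * Real.sqrt (1 - q ^ 2) * x) * Real.sqrt (1 - q) ^ n *
      ((-1 : ℝ) ^ k * q ^ ((k * (2 * k + 1) : ℤ) - (2 * n * k : ℤ)) *
          (Real.sqrt (1 - q ^ 2) * x / q) ^ (n - 2 * k) /
        (qPoch (q ^ 2) (q ^ 2) k * qPochAlpha q α (n - 2 * k)) -
      q ^ ((2 * α + 1) * theta n) *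
        ((-1 : ℝ) ^ k * q ^ ((k * (2 * k + 1) : ℤ) - (2 * n * k : ℤ)) *
          (Real.sqrt (1 - q ^ 2) * x) ^ (n - 2 * k) /
        (qPoch (q ^ 2) (q ^ 2) k * qPochAlpha q α (n - 2 * k)))) = qTerm α x n k q := by
  have hq2 : q ^ 2 < 1 := by nlinarith
  have hq0 : 0 < q ^ 2 := by positivity
  have T := theta_qnum q α h0 h1 n k hk
  have hF := (qFactAlpha_pos q α hα h0 h1 (n - 2 * k)).ne'
  have hK := (qFac_pos (q ^ 2) hq0 hq2 k).ne'
  have hu : 0 < Real.sqrt (1 - q) := Real.sqrt_pos.2 (by linarith)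
  have hv : 0 < Real.sqrt (1 + q) := Real.sqrt_pos.2 (by linarith)
  have eu : 1 - q = Real.sqrt (1 - q) ^ 2 := (Real.sq_sqrt (by linarith)).symm
  have ev : 1 + q = Real.sqrt (1 + q) ^ 2 := (Real.sq_sqrt (by linarith)).symm
  have e12 : 1 - q ^ 2 = (1 - q) * (1 + q) := by ring
  have euv : Real.sqrt (1 - q ^ 2) = Real.sqrt (1 - q) * Real.sqrt (1 + q) := by
    rw [e12, Real.sqrt_mul (by linarith)]
  obtain ⟨m, rfl⟩ : ∃ m, n = m + 2 * k := ⟨n - 2 * k, by omega⟩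
  rw [qPoch_eq_qFac _ hq0 hq2, euv, e12]
  unfold qTerm qPochAlpha
  simp only [Nat.add_sub_cancel] at *
  set Z := q ^ ((k * (2 * k + 1) : ℤ) - (2 * (m + 2 * k : ℕ) * k : ℤ)) with hZ
  set W := q ^ ((2 * α + 1) * theta (m + 2 * k)) with hW
  set F := qFactAlpha q α m
  set K := qFac (q ^ 2) k
  set A := qNumAlpha q α m
  set u := Real.sqrt (1 - q)
  set v := Real.sqrt (1 + q)
  have hWe : W = (q ^ m)⁻¹ - (q ^ m)⁻¹ * (u ^ 2 * A) := by rw [← eu]; linarith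
  rw [hWe, eu, ev, div_pow, mul_pow, mul_pow]
  have hqm : q ^ m ≠ 0 := by positivity
  field_simp
  ring

lemma HGen_deriv (ν x : ℝ) (hx : x ≠ 0) (n : ℕ) :
    HasDerivAt (HGen ν n) ((Nat.factorial n : ℝ) * ∑ k ∈ Finset.range (n / 2 + 1),
      (-1 : ℝ) ^ k * (((n - 2 * k : ℕ) : ℝ) * (2 * x) ^ (n - 2 * k) / x) /
        ((Nat.factorial k : ℝ) * gammaGen ν (n - 2 * k))) x := by
  unfold HGen
  refine HasDerivAt.const_mul _ (HasDerivAt.fun_sum fun k _ => ?_)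
  refine HasDerivAt.div_const (HasDerivAt.const_mul _ ?_) _
  have h := ((hasDerivAt_id x).const_mul 2).pow (n - 2 * k)
  refine h.congr_deriv ?_
  simp only [id, mul_one]
  rcases Nat.eq_zero_or_pos (n - 2 * k) with h0 | h0
  · simp [h0]
  · obtain ⟨m, hm⟩ : ∃ m, n - 2 * k = m + 1 := ⟨n - 2 * k - 1, by omega⟩
    rw [hm, Nat.add_sub_cancel, pow_succ]
    field_simp

lemma phiGen_dunkl (α x : ℝ) (hx : x ≠ 0) (n : ℕ) :
    deriv (phiGen (α + 1 / 2) n) x +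
          (α + 1 / 2) / x * (phiGen (α + 1 / 2) n x - phiGen (α + 1 / 2) n (-x)) +
          x * phiGen (α + 1 / 2) n x =
    Real.sqrt (gammaGen (α + 1 / 2) n / Real.Gamma (α + 1)) * Real.exp (-x ^ 2 / 2) *
      ∑ k ∈ Finset.range (n / 2 + 1), (-1 : ℝ) ^ k * (2 * x) ^ (n - 2 * k) / x * numL α (n - 2 * k) /
        ((Nat.factorial k : ℝ) * gammaGen (α + 1 / 2) (n - 2 * k)) / 2 ^ ((n : ℝ) / 2) := by
  have hE : HasDerivAt (fun x : ℝ => Real.exp (-x ^ 2 / 2)) (Real.exp (-x ^ 2 / 2) * (-x)) x := by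
    have h1 : HasDerivAt (fun x : ℝ => -x ^ 2 / 2) (-x) x := by
      refine (((hasDerivAt_id x).pow 2).neg.div_const 2).congr_deriv ?_
      simp
      ring
    exact h1.exp
  have hD : HasDerivAt (phiGen (α + 1 / 2) n) _ x :=
    ((hE.const_mul (Real.sqrt (gammaGen (α + 1 / 2) n / Real.Gamma (α + 1 / 2 + 1 / 2)))).mul
      (HGen_deriv (α + 1 / 2) x hx n)).div_const ((2 : ℝ) ^ ((n : ℝ) / 2) * (Nat.factorial n : ℝ))
  rw [hD.deriv]
  unfold phiGen
  have e : α + 1 / 2 + 1 / 2 = α + 1 := by ring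
  rw [e, neg_sq]
  set C := Real.sqrt (gammaGen (α + 1 / 2) n / Real.Gamma (α + 1))
  set E := Real.exp (-x ^ 2 / 2)
  have hf : (Nat.factorial n : ℝ) ≠ 0 := by positivity
  have h2 : (2 : ℝ) ^ ((n : ℝ) / 2) ≠ 0 := by positivity
  have key : (∑ k ∈ Finset.range (n / 2 + 1), (-1 : ℝ) ^ k * (2 * x) ^ (n - 2 * k) / x * numL α (n - 2 * k) /
        ((Nat.factorial k : ℝ) * gammaGen (α + 1 / 2) (n - 2 * k)) / 2 ^ ((n : ℝ) / 2)) =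
      ((∑ k ∈ Finset.range (n / 2 + 1),
      (-1 : ℝ) ^ k * (((n - 2 * k : ℕ) : ℝ) * (2 * x) ^ (n - 2 * k) / x) /
        ((Nat.factorial k : ℝ) * gammaGen (α + 1 / 2) (n - 2 * k))) + (α + 1 / 2) / x *
        (HGen (α + 1 / 2) n x / Nat.factorial n - HGen (α + 1 / 2) n (-x) / Nat.factorial n)) / 2 ^ ((n : ℝ) / 2) := by
    unfold HGen
    rw [mul_div_cancel_left₀ _ hf, mul_div_cancel_left₀ _ hf, ← Finset.sum_sub_distrib,
      Finset.mul_sum, ← Finset.sum_add_distrib, Finset.sum_div]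
    refine Finset.sum_congr rfl (fun k _ => ?_)
    have : (2 * -x) ^ (n - 2 * k) = (-1) ^ (n - 2 * k) * (2 * x) ^ (n - 2 * k) := by
      rw [← mul_pow]; congr 1; ring
    rw [this]
    unfold numL
    ring
  rw [key]
  field_simp
  ring

lemma alg_id (a s D R c e U f P w S1 S2 W : ℝ) (hP : P ≠ 0) :
    a * (s / D) * (R * (c * e * (U * f) / P * w * (P * S1)) -
      W * (c * e * (U * f) / P * (R * w) * (P * S2))) =
    a * c * (R * w) * (s * e) * f * (1 / D * U * (S1 - W * S2)) := by
  have h1 : c * e * (U * f) / P * w * (P * S1) = c * e * (U * f) * w * S1 := by field_simp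
  have h2 : c * e * (U * f) / P * (R * w) * (P * S2) = c * e * (U * f) * (R * w) * S2 := by
    field_simp
  rw [h1, h2]
  ring

lemma expr_eq (q α x : ℝ) (hα : -1 < α) (hx : x ≠ 0) (h0 : 0 < q) (h1 : q < 1) (n : ℕ) :
    (1 - q ^ 2) ^ ((α + 1) / 2) *
          (Real.sqrt q / (Real.sqrt (1 - q) * Real.sqrt (1 - q ^ 2) * x)) *
          (Real.sqrt (1 + q ^ (-(2 * α + 3)) * (1 - q ^ 2) * x ^ 2) *
              phiQ q α n (Real.sqrt (1 - q ^ 2) * x / q) -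
            q ^ ((2 * α + 1) * theta n) * phiQ q α n (Real.sqrt (1 - q ^ 2) * x)) =
    ((1 - q ^ 2) ^ ((α + 1) / 2) * cAlpha q α) *
      Real.sqrt (omegaAlpha q α (Real.sqrt (1 - q ^ 2) * x)) *
      (Real.sqrt q * q ^ (((n : ℝ) ^ 2) / 2)) * Real.sqrt (qFactAlpha q α n) *
      ∑ k ∈ Finset.range (n / 2 + 1), qTerm α x n k q := by
  have hq2 : q ^ 2 < 1 := by nlinarith
  have hS := omega_shift q α (Real.sqrt (1 - q ^ 2) * x) h0 h1
  rw [mul_pow, Real.sq_sqrt (by linarith), ← mul_assoc] at hS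
  have hsum : ∑ k ∈ Finset.range (n / 2 + 1), qTerm α x n k q =
      1 / (Real.sqrt (1 - q) * Real.sqrt (1 - q ^ 2) * x) * Real.sqrt (1 - q) ^ n *
      (∑ k ∈ Finset.range (n / 2 + 1), ((-1 : ℝ) ^ k * q ^ ((k * (2 * k + 1) : ℤ) - (2 * n * k : ℤ)) *
          (Real.sqrt (1 - q ^ 2) * x / q) ^ (n - 2 * k) /
        (qPoch (q ^ 2) (q ^ 2) k * qPochAlpha q α (n - 2 * k))) -
      q ^ ((2 * α + 1) * theta n) *
        ∑ k ∈ Finset.range (n / 2 + 1), ((-1 : ℝ) ^ k * q ^ ((k * (2 * k + 1) : ℤ) - (2 * n * k : ℤ)) *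
          (Real.sqrt (1 - q ^ 2) * x) ^ (n - 2 * k) /
        (qPoch (q ^ 2) (q ^ 2) k * qPochAlpha q α (n - 2 * k)))) := by
    rw [Finset.mul_sum, ← Finset.sum_sub_distrib, Finset.mul_sum]
    refine Finset.sum_congr rfl (fun k hk => ?_)
    rw [term_id q α x hα h0 h1 hx n k (by have := Finset.mem_range.1 hk; omega)]
  rw [hsum]
  have hP : qPoch q q n ≠ 0 := by
    rw [qPoch_eq_qFac q h0 h1]
    exact (mul_pos (pow_pos (by linarith) n) (qFac_pos q h0 h1 n)).ne'
  have hsq : Real.sqrt (qPochAlpha q α n) = Real.sqrt (1 - q) ^ n * Real.sqrt (qFactAlpha q α n) := by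
    unfold qPochAlpha
    rw [Real.sqrt_mul (pow_nonneg (by linarith) n)]
    congr 1
    rw [Real.sqrt_eq_iff_mul_self_eq (pow_nonneg (by linarith) n) (by positivity), ← mul_pow,
      Real.mul_self_sqrt (by linarith)]
  unfold phiQ dAlpha hTilde
  rw [hsq]
  rw [← hS]
  exact alg_id _ _ _ _ _ _ _ _ _ _ _ _ _ hP

/-- limit of the annihilation operator to the Calogero annihilation
operator `(1/√2)(Λ_{α+1/2} + x)`. -/
theorem stmt_18 (α : ℝ) (hα : -1 < α) (n : ℕ) (x : ℝ) (hx : x ≠ 0) :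
    Tendsto (fun q : ℝ =>
        (1 - q ^ 2) ^ ((α + 1) / 2) *
          (Real.sqrt q / (Real.sqrt (1 - q) * Real.sqrt (1 - q ^ 2) * x)) *
          (Real.sqrt (1 + q ^ (-(2 * α + 3)) * (1 - q ^ 2) * x ^ 2) *
              phiQ q α n (Real.sqrt (1 - q ^ 2) * x / q) -
            q ^ ((2 * α + 1) * theta n) * phiQ q α n (Real.sqrt (1 - q ^ 2) * x)))
      (nhdsWithin 1 (Set.Ioo 0 1))
      (nhds (1 / Real.sqrt 2 *
        (deriv (phiGen (α + 1 / 2) n) x +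
          (α + 1 / 2) / x * (phiGen (α + 1 / 2) n x - phiGen (α + 1 / 2) n (-x)) +
          x * phiGen (α + 1 / 2) n x))) := by
  rw [phiGen_dunkl α x hx n]
  have hG := Real.Gamma_pos_of_pos (show 0 < α + 1 by linarith)
  have hω := (tendsto_omega α x).sqrt
  have hq : Tendsto (fun q : ℝ => Real.sqrt q * q ^ (((n : ℝ) ^ 2) / 2))
      (nhdsWithin 1 (Set.Ioo 0 1)) (nhds 1) := by
    have := tendsto_id_within.sqrt.mul (tendsto_rpow_one (((n : ℝ) ^ 2) / 2))
    rwa [Real.sqrt_one, one_mul] at this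
  have hT := tendsto_finsetSum (Finset.range (n / 2 + 1)) (fun k _ => tendsto_term α x hα n k)
  have H := ((((tendsto_cAlpha α hα).mul hω).mul hq).mul (tendsto_qFactAlpha α hα n).sqrt).mul hT
  have e : ∀ q ∈ Set.Ioo (0 : ℝ) 1, _ := fun q hq => expr_eq q α x hα hx hq.1 hq.2 n
  refine Tendsto.congr' ?_ (Tendsto.mono_right H (le_of_eq ?_))
  · filter_upwards [ev_Ioo] with q hq
    exact (e q hq).symm
  · congr 1
    have h1 : Real.sqrt (Real.exp (-x ^ 2)) = Real.exp (-x ^ 2 / 2) := by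
      rw [Real.exp_half]
    have h2 : Real.sqrt (gammaGen (α + 1 / 2) n / Real.Gamma (α + 1)) =
        Real.sqrt (1 / Real.Gamma (α + 1)) * Real.sqrt (gammaGen (α + 1 / 2) n) := by
      rw [← Real.sqrt_mul (by positivity)]
      congr 1; ring
    rw [h1, h2, mul_one, Finset.mul_sum, Finset.mul_sum, Finset.mul_sum]
    refine Finset.sum_congr rfl (fun k hk => ?_)
    have hk' : 2 * k ≤ n := by have := Finset.mem_range.1 hk; omega
    have h3 : (2 : ℝ) ^ ((n : ℝ) / 2) = Real.sqrt 2 ^ (n - 2 * k) * 2 ^ k := by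
      have h4 : (2 : ℝ) ^ k = Real.sqrt 2 ^ (2 * k) := by
        rw [pow_mul, Real.sq_sqrt (by norm_num)]
      rw [h4, ← pow_add, Nat.sub_add_cancel hk', Real.sqrt_eq_rpow, ← Real.rpow_natCast,
        ← Real.rpow_mul (by norm_num)]
      congr 1; ring
    have h5 : (2 * x) ^ (n - 2 * k) = Real.sqrt 2 ^ (n - 2 * k) * Real.sqrt 2 ^ (n - 2 * k) * x ^ (n - 2 * k) := by
      rw [← mul_pow, Real.mul_self_sqrt (by norm_num), mul_pow]
    rw [h3, h5]
    have := (gammaGen_pos α hα (n - 2 * k)).ne'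
    field_simp
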